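/- Fix λ > 0. There exists a constant C > 0 such that for all α ∈ [1,2] and all x, y ∈ ℝ with x ≠ y, g_λ^α(x,y) ≤ g_λ^1(x,y) + C, where g_λ^α(x,y) := ∫₀^∞ e^{−λt} p^α(t, x−y) dt. -/

import Mathlib

open Real MeasureTheory Set Filter Topology

lemma aux_int (α s : ℝ) (hα : 1 ≤ α) (hs : 0 < s) :
    IntegrableOn (fun θ : ℝ => Real.exp (-s * θ ^ α)) (Ioi 0) := by
  have h := integrableOn_rpow_mul_exp_neg_mul_rpow (p := α) (s := 0) (b := s) (by norm_num) (by linarith) hs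
  simpa using h

lemma aux_int_cos (α s r : ℝ) (hα : 1 ≤ α) (hs : 0 < s) :
    IntegrableOn (fun θ : ℝ => Real.cos (θ * r) * Real.exp (-s * θ ^ α)) (Ioi 0) := by
  refine (aux_int α s hα hs).bdd_mul (c := 1) ?_ ?_
  · exact Continuous.aestronglyMeasurable (by fun_prop)
  · exact Eventually.of_forall fun θ => by simpa using Real.abs_cos_le_one _

/-- Tail bound by integration by parts. -/
lemma aux_tail (α s r a : ℝ) (hα : 1 ≤ α) (hs : 0 < s) (hr : 0 < r) (ha : 0 ≤ a) :
    |∫ θ in Ioi a, Real.cos (θ * r) * Real.exp (-s * θ ^ α)| ≤ 2 / r * Real.exp (-s * a ^ α) := by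
  have hα0 : 0 < α := by linarith
  set f : ℝ → ℝ := fun θ => Real.exp (-s * θ ^ α) with hf
  set f' : ℝ → ℝ := fun θ => Real.exp (-s * θ ^ α) * (-s * (α * θ ^ (α - 1))) with hf'
  have hder : ∀ θ ∈ Ioi a, HasDerivAt f (f' θ) θ := by
    intro θ _
    exact ((Real.hasDerivAt_rpow_const (Or.inr hα)).const_mul (-s)).exp
  have hcont : Continuous f := by
    have : Continuous fun θ : ℝ => θ ^ α := Real.continuous_rpow_const hα0.le
    fun_prop
  have hneg : ∀ θ ∈ Ioi a, f' θ ≤ 0 := by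
    intro θ hθ
    have hθ0 : 0 < θ := lt_of_le_of_lt ha hθ
    have h1 : 0 ≤ α * θ ^ (α - 1) := by positivity
    have h2 : -s * (α * θ ^ (α - 1)) ≤ 0 := by nlinarith
    exact mul_nonpos_of_nonneg_of_nonpos (Real.exp_pos _).le h2
  have hlim : Tendsto f atTop (𝓝 0) := by
    have h1 : Tendsto (fun θ : ℝ => -s * θ ^ α) atTop atBot :=
      (tendsto_rpow_atTop hα0).const_mul_atTop_of_neg (by linarith)
    exact Real.tendsto_exp_atBot.comp h1
  have hf'int : IntegrableOn f' (Ioi a) :=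
    integrableOn_Ioi_deriv_of_nonpos hcont.continuousWithinAt hder hneg hlim
  have hf'val : ∫ θ in Ioi a, f' θ = 0 - f a :=
    integral_Ioi_of_hasDerivAt_of_tendsto hcont.continuousWithinAt hder hf'int hlim
  have hcf : IntegrableOn (fun θ : ℝ => Real.cos (θ * r) * f θ) (Ioi a) :=
    (aux_int_cos α s r hα hs).mono_set (Ioi_subset_Ioi ha)
  have hsf : IntegrableOn (fun θ : ℝ => (Real.sin (θ * r) / r) * f' θ) (Ioi a) := by
    refine hf'int.bdd_mul (c := 1 / r) ?_ ?_
    · exact Continuous.aestronglyMeasurable (by fun_prop)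
    · refine Eventually.of_forall fun θ => ?_
      rw [Real.norm_eq_abs, abs_div, abs_of_pos hr]
      gcongr
      exact Real.abs_sin_le_one _
  have hsinb : ∀ θ : ℝ, |Real.sin (θ * r) / r| ≤ 1 / r := by
    intro θ
    rw [abs_div, abs_of_pos hr]
    gcongr
    exact Real.abs_sin_le_one _
  have hH : ∫ θ in Ioi a, (Real.cos (θ * r) * f θ + (Real.sin (θ * r) / r) * f' θ)
      = 0 - (Real.sin (a * r) / r) * f a := by
    refine integral_Ioi_of_hasDerivAt_of_tendsto (f := fun θ => (Real.sin (θ * r) / r) * f θ)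
      (Continuous.continuousWithinAt (by fun_prop)) ?_ (hcf.add hsf) ?_
    · intro θ hθ
      have h1 : HasDerivAt (fun θ : ℝ => Real.sin (θ * r) / r) (Real.cos (θ * r)) θ := by
        have := (((hasDerivAt_id θ).mul_const r).sin).div_const r
        simp only [id] at this
        rw [one_mul, mul_div_assoc, div_self hr.ne', mul_one] at this
        exact this
      exact h1.mul (hder θ hθ)
    · have h0 : Tendsto (fun θ => 1 / r * f θ) atTop (𝓝 0) := by
        simpa using hlim.const_mul (1 / r)
      refine squeeze_zero_norm (fun θ => ?_) h0
      rw [norm_mul, Real.norm_eq_abs, Real.norm_eq_abs, abs_of_pos (Real.exp_pos _ : 0 < f θ)]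
      exact mul_le_mul_of_nonneg_right (hsinb θ) (Real.exp_pos _).le
  rw [integral_add hcf hsf] at hH
  have hB : |∫ θ in Ioi a, (Real.sin (θ * r) / r) * f' θ| ≤ 1 / r * f a := by
    have : ‖∫ θ in Ioi a, (Real.sin (θ * r) / r) * f' θ‖ ≤ ∫ θ in Ioi a, (1 / r) * (- f' θ) := by
      refine norm_integral_le_of_norm_le (hf'int.neg.const_mul _) ?_
      filter_upwards [ae_restrict_mem measurableSet_Ioi] with θ hθ
      rw [norm_mul, Real.norm_eq_abs, Real.norm_eq_abs, abs_of_nonpos (hneg θ hθ)]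
      exact mul_le_mul_of_nonneg_right (hsinb θ) (by linarith [hneg θ hθ])
    rw [integral_const_mul, integral_neg, hf'val] at this
    simpa using this
  have hA : |(Real.sin (a * r) / r) * f a| ≤ 1 / r * f a := by
    rw [abs_mul, abs_of_pos (Real.exp_pos _ : 0 < f a)]
    exact mul_le_mul_of_nonneg_right (hsinb a) (Real.exp_pos _).le
  have e : 2 / r * Real.exp (-s * a ^ α) = 1 / r * f a + 1 / r * f a := by
    simp only [hf]; ring
  rw [e]
  rw [abs_le] at *
  constructor <;> linarith [hA.1, hA.2, hB.1, hB.2]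

lemma aux_cmp (α s r : ℝ) (hα : 1 ≤ α) (hs : 0 < s) (hr : 0 < r) :
    (∫ θ in Ioi (0:ℝ), Real.cos (θ * r) * Real.exp (-s * θ ^ α)) ≤
      (∫ θ in Ioi (0:ℝ), Real.cos (θ * r) * Real.exp (-s * θ ^ (1:ℝ))) + 1
        + 4 / r * Real.exp (-s * max 1 (1 / r)) := by
  set a := max 1 (1 / r) with ha
  have ha1 : 1 ≤ a := le_max_left _ _
  have hi := aux_int_cos α s r hα hs
  have hi1 := aux_int_cos 1 s r le_rfl hs
  have hun : Ioi (0:ℝ) = Ioc 0 a ∪ Ioi a := (Ioc_union_Ioi_eq_Ioi (by linarith)).symm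
  have hsub1 : Ioc 0 a ⊆ Ioi (0:ℝ) := Ioc_subset_Ioi_self
  have hsub2 : Ioi a ⊆ Ioi (0:ℝ) := Ioi_subset_Ioi (by linarith)
  have split : ∀ β : ℝ, 1 ≤ β → (∫ θ in Ioi (0:ℝ), Real.cos (θ * r) * Real.exp (-s * θ ^ β)) =
      (∫ θ in Ioc 0 a, Real.cos (θ * r) * Real.exp (-s * θ ^ β))
      + ∫ θ in Ioi a, Real.cos (θ * r) * Real.exp (-s * θ ^ β) := by
    intro β hβ
    have h := aux_int_cos β s r hβ hs
    rw [hun]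
    exact setIntegral_union (Ioc_disjoint_Ioi le_rfl) measurableSet_Ioi
      (h.mono_set hsub1) (h.mono_set hsub2)
  have tα := (abs_le.1 (aux_tail α s r a hα hs hr (by linarith))).2
  have t1 := (abs_le.1 (aux_tail 1 s r a le_rfl hs hr (by linarith))).1
  have hexp : Real.exp (-s * a ^ α) ≤ Real.exp (-s * a) := by
    apply Real.exp_le_exp.2
    have := Real.self_le_rpow_of_one_le ha1 hα
    nlinarith
  have hexp' : 2 / r * Real.exp (-s * a ^ α) ≤ 2 / r * Real.exp (-s * a) := by gcongr
  rw [Real.rpow_one] at t1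
  have hfour : 4 / r * Real.exp (-s * a) = 2 / r * Real.exp (-s * a) + 2 / r * Real.exp (-s * a) := by
    ring
  have hmid : (∫ θ in Ioc 0 a, Real.cos (θ * r) * Real.exp (-s * θ ^ α)) ≤
      (∫ θ in Ioc 0 a, Real.cos (θ * r) * Real.exp (-s * θ ^ (1:ℝ))) + 1 := by
    have hone : (1:ℝ) = ∫ θ in Ioc 0 a, (Ioc (0:ℝ) 1).indicator (fun _ => (1:ℝ)) θ := by
      rw [setIntegral_indicator measurableSet_Ioc, Ioc_inter_Ioc]
      simp [ha1]
    have hindi : IntegrableOn ((Ioc (0:ℝ) 1).indicator (fun _ => (1:ℝ))) (Ioc 0 a) := by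
      refine IntegrableOn.integrable ?_ |>.indicator measurableSet_Ioc
      simp
    refine le_of_le_of_eq ?_ (congrArg (fun v => (∫ θ in Ioc 0 a,
      Real.cos (θ * r) * Real.exp (-s * θ ^ (1:ℝ))) + v) hone.symm)
    rw [← integral_add (hi1.mono_set hsub1) hindi]
    refine setIntegral_mono_on (hi.mono_set hsub1)
      ((hi1.mono_set hsub1).add hindi) measurableSet_Ioc ?_
    intro θ hθ
    have hθ0 : 0 < θ := hθ.1
    rw [Real.rpow_one]
    have hp1 := Real.exp_pos (-s * θ)
    have hp2 := Real.exp_pos (-s * θ ^ α)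
    by_cases h1 : θ ≤ 1
    · rw [indicator_of_mem (show θ ∈ Ioc (0:ℝ) 1 from ⟨hθ0, h1⟩)]
      have e1 : Real.exp (-s * θ) ≤ 1 := Real.exp_le_one_iff.2 (by nlinarith)
      have e2 : Real.exp (-s * θ ^ α) ≤ 1 := Real.exp_le_one_iff.2 (by
        have : 0 < θ ^ α := by positivity
        nlinarith)
      have c1 := Real.cos_le_one (θ * r)
      have c2 := Real.neg_one_le_cos (θ * r)
      have d : |Real.exp (-s * θ ^ α) - Real.exp (-s * θ)| ≤ 1 := by
        rw [abs_le]; constructor <;> linarith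
      have c : |Real.cos (θ * r)| ≤ 1 := Real.abs_cos_le_one _
      have := mul_le_one₀ c (abs_nonneg _) d
      rw [← abs_mul] at this
      have := le_of_abs_le this
      linarith
    · push Not at h1
      rw [indicator_of_notMem (show θ ∉ Ioc (0:ℝ) 1 from fun h => absurd h.2 (not_le.2 h1))]
      have hθr : θ ≤ 1 / r := by
        rcases le_max_iff.1 hθ.2 with h | h
        · linarith
        · exact h
      have hc : θ * r ≤ 1 := (le_div_iff₀ hr).1 hθr
      have hcos : 0 ≤ Real.cos (θ * r) := by
        apply Real.cos_nonneg_of_mem_Icc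
        have := Real.pi_gt_three
        have : 0 < θ * r := by positivity
        constructor <;> linarith
      have he : Real.exp (-s * θ ^ α) ≤ Real.exp (-s * θ) := by
        apply Real.exp_le_exp.2
        have := Real.self_le_rpow_of_one_le h1.le hα
        nlinarith
      have := mul_le_mul_of_nonneg_left he hcos
      linarith
  rw [split α hα, split 1 le_rfl]
  linarith

lemma aux_line (α s z : ℝ) :
    (∫ θ : ℝ, Real.cos (θ * z) * Real.exp (-s * |θ| ^ α)) =
      2 * ∫ θ in Ioi (0:ℝ), Real.cos (θ * |z|) * Real.exp (-s * θ ^ α) := by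
  rw [← integral_comp_abs (f := fun θ => Real.cos (θ * |z|) * Real.exp (-s * θ ^ α))]
  congr 1
  ext θ
  rw [← abs_mul, Real.cos_abs]

lemma aux_F_int (lam α z : ℝ) (hlam : 0 < lam) (hα : 1 ≤ α) (hz : z ≠ 0) :
    IntegrableOn (fun t : ℝ => Real.exp (-lam * t) *
          ((1 / (2 * π)) * ∫ θ : ℝ, Real.cos (θ * z) * Real.exp (-(t / 2) * |θ| ^ α)))
      (Ioi 0) := by
  have hr : 0 < |z| := abs_pos.2 hz
  have hE : IntegrableOn (fun t : ℝ => Real.exp (-lam * t)) (Ioi 0) :=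
    integrableOn_exp_mul_Ioi (by linarith) 0
  have hmeas : StronglyMeasurable (fun t : ℝ =>
      ∫ θ : ℝ, Real.cos (θ * z) * Real.exp (-(t / 2) * |θ| ^ α)) := by
    refine StronglyMeasurable.integral_prod_right'
      (f := fun p : ℝ × ℝ => Real.cos (p.2 * z) * Real.exp (-(p.1 / 2) * |p.2| ^ α)) ?_
    refine Measurable.stronglyMeasurable ?_
    fun_prop
  refine hE.mul_bdd (c := (1 / (2 * π)) * (2 * (2 / |z|))) ?_ ?_
  · exact (hmeas.const_mul _).aestronglyMeasurable
  · filter_upwards [ae_restrict_mem measurableSet_Ioi] with t ht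
    have ht0 : 0 < t := ht
    rw [norm_mul, aux_line, norm_mul]
    have h := aux_tail α (t / 2) |z| 0 hα (by linarith) hr le_rfl
    rw [Real.zero_rpow (by linarith)] at h
    simp only [mul_zero, Real.exp_zero, mul_one] at h
    have e1 : ‖1 / (2 * π)‖ = 1 / (2 * π) := Real.norm_of_nonneg (by positivity)
    rw [e1, Real.norm_of_nonneg (by norm_num : (0:ℝ) ≤ 2), Real.norm_eq_abs]
    gcongr

theorem stmt14 (lam : ℝ) (hlam : 0 < lam) :
    ∃ C : ℝ, 0 < C ∧ ∀ α ∈ Icc (1:ℝ) 2, ∀ x y : ℝ, x ≠ y →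
      (∫ t in Ioi (0:ℝ), Real.exp (-lam * t) *
          ((1 / (2 * π)) * ∫ θ : ℝ, Real.cos (θ * (x - y)) * Real.exp (-(t / 2) * |θ| ^ α)))
        ≤ (∫ t in Ioi (0:ℝ), Real.exp (-lam * t) *
          ((1 / (2 * π)) * ∫ θ : ℝ, Real.cos (θ * (x - y)) * Real.exp (-(t / 2) * |θ|))) + C := by
  refine ⟨1 / π * (1 / lam + 8), by positivity, ?_⟩
  intro α hα x y hxy
  have hz : x - y ≠ 0 := sub_ne_zero.2 hxy
  set z := x - y
  have hr : 0 < |z| := abs_pos.2 hz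
  have hiα := aux_F_int lam α z hlam hα.1 hz
  have hi1 := aux_F_int lam 1 z hlam le_rfl hz
  have hone : (∫ t in Ioi (0:ℝ), Real.exp (-lam * t) *
          ((1 / (2 * π)) * ∫ θ : ℝ, Real.cos (θ * z) * Real.exp (-(t / 2) * |θ|))) =
      ∫ t in Ioi (0:ℝ), Real.exp (-lam * t) *
          ((1 / (2 * π)) * ∫ θ : ℝ, Real.cos (θ * z) * Real.exp (-(t / 2) * |θ| ^ (1:ℝ))) := by
    simp only [Real.rpow_one]
  rw [hone]
  set a := max 1 (1 / |z|) with ha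
  have ha1 : 1 ≤ a := le_max_left _ _
  have har : 1 / |z| ≤ a := le_max_right _ _
  have hE : IntegrableOn (fun t : ℝ => Real.exp (-lam * t)) (Ioi 0) :=
    integrableOn_exp_mul_Ioi (by linarith) 0
  have hE2 : IntegrableOn (fun t : ℝ => Real.exp (-(a / 2) * t)) (Ioi 0) :=
    integrableOn_exp_mul_Ioi (by linarith) 0
  have hEv : ∫ t in Ioi (0:ℝ), Real.exp (-lam * t) = 1 / lam := by
    rw [integral_exp_mul_Ioi (by linarith)]; simp
  have hE2v : ∫ t in Ioi (0:ℝ), Real.exp (-(a / 2) * t) = 2 / a := by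
    rw [integral_exp_mul_Ioi (by linarith)]; simp
  have hG : IntegrableOn (fun t : ℝ => 1 / π * Real.exp (-lam * t)
      + 1 / π * (4 / |z|) * Real.exp (-(a / 2) * t)) (Ioi 0) :=
    (hE.const_mul _).add (hE2.const_mul _)
  have hGv : ∫ t in Ioi (0:ℝ), (1 / π * Real.exp (-lam * t)
      + 1 / π * (4 / |z|) * Real.exp (-(a / 2) * t)) ≤ 1 / π * (1 / lam + 8) := by
    rw [integral_add (hE.const_mul _) (hE2.const_mul _), integral_const_mul, integral_const_mul,
      hEv, hE2v]
    have h1 : 1 ≤ a * |z| := (div_le_iff₀ hr).1 har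
    have h2 : 4 / |z| * (2 / a) ≤ 8 := by
      rw [div_mul_div_comm, div_le_iff₀ (by positivity)]
      nlinarith
    rw [mul_assoc, ← mul_add]
    gcongr
  refine le_trans ?_ (add_le_add_right hGv _)
  rw [← integral_add hi1 hG]
  refine setIntegral_mono_on hiα (hi1.add hG) measurableSet_Ioi ?_
  intro t ht
  have ht0 : 0 < t := ht
  rw [aux_line, aux_line]
  have h := aux_cmp α (t / 2) |z| hα.1 (by linarith) hr
  rw [← ha] at h
  set A := ∫ θ in Ioi (0:ℝ), Real.cos (θ * |z|) * Real.exp (-(t / 2) * θ ^ α)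
  set B := ∫ θ in Ioi (0:ℝ), Real.cos (θ * |z|) * Real.exp (-(t / 2) * θ ^ (1:ℝ))
  have e1 : -(t / 2) * a = -(a / 2) * t := by ring
  rw [e1] at h
  have hle : Real.exp (-lam * t) ≤ 1 := Real.exp_le_one_iff.2 (by nlinarith)
  have hpos := Real.exp_pos (-lam * t)
  set E := Real.exp (-lam * t)
  set X := Real.exp (-(a / 2) * t)
  have hX : 0 ≤ 4 / |z| * X := by positivity
  have k1 : E * A ≤ E * B + E + 4 / |z| * X := by
    have := mul_le_mul_of_nonneg_left h hpos.le
    nlinarith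
  have hpi : 0 < 1 / π := by positivity
  have k2 := mul_le_mul_of_nonneg_left k1 hpi.le
  have e2 : E * (1 / (2 * π) * (2 * A)) = 1 / π * (E * A) := by field_simp
  have e3 : E * (1 / (2 * π) * (2 * B)) = 1 / π * (E * B) := by field_simp
  rw [e2, e3]
  linarith
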